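/- arXiv:1805.00374 — 8 statements merged into one kernel-verified Lean document; each statement's English description precedes it below -/
import Mathlib

section
/- Let f : K → L be a morphism of filtered cochain complexes of R-modules and r ≥ 0. If the induced maps Z_r(f) and E_{r+1}(f) are bidegree-wise surjective, then Z_{r+1}(f) is bidegree-wise surjective. -/
open scoped Classical

/-- A filtered (cochain) complex of `R`-modules, with differentials given in
"all indices" form: `d i j` is the differential `X i → X j`, which vanishes
unless `j = i + 1`. The filtration `F n` on `X n` is increasing and preserved
by the differential. -/
structure FilteredComplex (R : Type) [CommRing R] where
  X : ℤ → Type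
  [addgrp : ∀ n, AddCommGroup (X n)]
  [mod : ∀ n, Module R (X n)]
  d : ∀ i j : ℤ, X i →ₗ[R] X j
  d_ne : ∀ i j, j ≠ i + 1 → d i j = 0
  d_sq : ∀ i j k x, d j k (d i j x) = 0
  F : ∀ n, ℤ → Submodule R (X n)
  F_mono : ∀ n, Monotone (F n)
  d_filt : ∀ i j p x, x ∈ F i p → d i j x ∈ F j p

attribute [instance] FilteredComplex.addgrp FilteredComplex.mod

variable {R : Type} [CommRing R]

/-- The `r`-cycles `Z_r^{p,n+p}(A) = F_p A^n ∩ d⁻¹(F_{p-r} A^{n+1})`. -/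
def Zc (A : FilteredComplex R) (r : ℕ) (p n : ℤ) : Submodule R (A.X n) :=
  A.F n p ⊓ (A.F (n+1) (p - (r:ℤ))).comap (A.d n (n+1))

/-- The `r`-boundaries `B_r^{p,n+p}(A) = Z_{r-1}^{p-1,n+p-1}(A) + d Z_{r-1}^{p+r-1,n+p+r-2}(A)`
(for `r ≥ 1`; for `r = 0` this agrees with `B_0 = Z_0^{p-1}`). -/
def Bd (A : FilteredComplex R) (r : ℕ) (p n : ℤ) : Submodule R (A.X n) :=
  Zc A (r-1) (p-1) n ⊔ (Zc A (r-1) (p + (r:ℤ) - 1) (n-1)).map (A.d (n-1) n)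

/-- Morphisms of filtered complexes. -/
structure FCHom (A B : FilteredComplex R) where
  f : ∀ n, A.X n →ₗ[R] B.X n
  comm : ∀ i j x, f j (A.d i j x) = B.d i j (f i x)
  filt : ∀ n p x, x ∈ A.F n p → f n x ∈ B.F n p

def FCHom.comp {A B C : FilteredComplex R} (g : FCHom B C) (φ : FCHom A B) : FCHom A C where
  f := fun n => (g.f n).comp (φ.f n)
  comm := by intro i j x; simp [LinearMap.comp_apply, φ.comm, g.comm]
  filt := fun n p x hx => g.filt n p _ (φ.filt n p x hx)

def FCHom.id' (A : FilteredComplex R) : FCHom A A :=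
  ⟨fun _ => LinearMap.id, fun _ _ _ => rfl, fun _ _ _ hx => hx⟩

def FCHom.zero (A B : FilteredComplex R) : FCHom A B :=
  ⟨fun _ => 0, by intro i j x; simp, by intro n p x _; simp⟩

/-- `Z_r(φ)` is bidegree-wise surjective. -/
def ZSurjF {A B : FilteredComplex R} (φ : FCHom A B) (r : ℕ) : Prop :=
  ∀ p n, ∀ b ∈ Zc B r p n, ∃ a ∈ Zc A r p n, φ.f n a = b

/-- `E_r(φ)` is bidegree-wise surjective (elementwise formulation, `r ≥ 1` pages). -/
def ESurjF {A B : FilteredComplex R} (φ : FCHom A B) (r : ℕ) : Prop :=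
  ∀ p n, ∀ b ∈ Zc B r p n, ∃ a ∈ Zc A r p n, φ.f n a - b ∈ Bd B r p n

/-- `E_r(φ)` is bidegree-wise injective (elementwise formulation). -/
def EInjF {A B : FilteredComplex R} (φ : FCHom A B) (r : ℕ) : Prop :=
  ∀ p n, ∀ a ∈ Zc A r p n, φ.f n a ∈ Bd B r p n → a ∈ Bd A r p n

/-- `φ` is an `E_r`-quasi-isomorphism: `E_{r+1}(φ)` is an isomorphism. -/
def IsErQisF {A B : FilteredComplex R} (φ : FCHom A B) (r : ℕ) : Prop :=
  ESurjF φ (r+1) ∧ EInjF φ (r+1)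

/-- The `r`-shift `S^r`: `(S^r F)_p A^n = F_{p + r n} A^n`. -/
def Shift (r : ℕ) (A : FilteredComplex R) : FilteredComplex R :=
  { A with
    F := fun n p => A.F n (p + (r:ℤ) * n)
    F_mono := fun n _ _ h => A.F_mono n (by omega)
    d_filt := by
      intro i j p x hx
      by_cases h : j = i + 1
      · subst h
        refine A.F_mono (i+1) ?_ (A.d_filt i (i+1) _ x hx)
        have hr : (0:ℤ) ≤ (r:ℤ) := Int.natCast_nonneg r
        nlinarith
      · rw [A.d_ne i j h]; simp }

/-- The `r`-décalage `Dec^r`: `(Dec^r F)_p A^n = F_{p - rn} A^n ∩ d⁻¹(F_{p-r(n+1)} A^{n+1})`. -/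
def Dec (r : ℕ) (A : FilteredComplex R) : FilteredComplex R :=
  { A with
    F := fun n p => A.F n (p - (r:ℤ) * n) ⊓
      (A.F (n+1) (p - (r:ℤ) * (n+1))).comap (A.d n (n+1))
    F_mono := fun n a b h => inf_le_inf (A.F_mono n (by omega))
      (Submodule.comap_mono (A.F_mono (n+1) (by omega)))
    d_filt := by
      intro i j p x hx
      by_cases h : j = i + 1
      · subst h
        rw [Submodule.mem_inf] at hx ⊢
        refine ⟨hx.2, ?_⟩
        rw [Submodule.mem_comap, A.d_sq]
        exact Submodule.zero_mem _
      · rw [A.d_ne i j h]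
        exact Submodule.zero_mem _ }

/-- Shift of a morphism. -/
def ShiftHom (r : ℕ) {A B : FilteredComplex R} (φ : FCHom A B) :
    FCHom (Shift r A) (Shift r B) :=
  ⟨φ.f, φ.comm, fun n p x hx => φ.filt n (p + (r:ℤ) * n) x hx⟩

theorem FilteredComplex.d_mem_of_mem_Zc (A : FilteredComplex R) {r : ℕ} {p i : ℤ} (j : ℤ)
    {x : A.X i} (hx : x ∈ Zc A r p i) : A.d i j x ∈ A.F j (p - r) := by
  by_cases h : j = i + 1
  · subst h
    exact hx.2
  · simp [A.d_ne i j h]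

theorem Bd_succ_le_Zc (A : FilteredComplex R) (r : ℕ) (p n : ℤ) :
    Bd A (r + 1) p n ≤ Zc A (r + 1) p n := by
  refine sup_le (fun z hz => ⟨A.F_mono n (by omega) hz.1, ?_⟩) ?_
  · exact A.F_mono (n + 1) (by push_cast; omega) hz.2
  · rintro _ ⟨w, hw, rfl⟩
    refine ⟨A.F_mono n (by push_cast; omega) (A.d_mem_of_mem_Zc n hw), ?_⟩
    rw [SetLike.mem_coe, Submodule.mem_comap, A.d_sq]
    exact Submodule.zero_mem _

theorem ZSurjF.exists_mem_Bd_succ {A B : FilteredComplex R} {φ : FCHom A B} {r : ℕ}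
    (hφ : ZSurjF φ r) {p n : ℤ} {b : B.X n} (hb : b ∈ Bd B (r + 1) p n) :
    ∃ a ∈ Bd A (r + 1) p n, φ.f n a = b := by
  obtain ⟨z, hz, _, ⟨w, hw, rfl⟩, rfl⟩ := Submodule.mem_sup.1 hb
  obtain ⟨z', hz', rfl⟩ := hφ _ _ z hz
  obtain ⟨w', hw', rfl⟩ := hφ _ _ w hw
  exact ⟨z' + A.d (n - 1) n w',
    Submodule.add_mem_sup hz' (Submodule.mem_map_of_mem hw'), by rw [map_add, φ.comm]⟩

/-- If `Z_r(f)` and `E_{r+1}(f)` are bidegree-wise surjective, then so is `Z_{r+1}(f)`. -/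
theorem stmt0 {R : Type} [CommRing R] {K L : FilteredComplex R} (φ : FCHom K L) (r : ℕ)
    (hZ : ZSurjF φ r) (hE : ESurjF φ (r+1)) : ZSurjF φ (r+1) := by
  intro p n b hb
  obtain ⟨a, ha, hab⟩ := hE p n b hb
  obtain ⟨c, hc, hcb⟩ := hZ.exists_mem_Bd_succ hab
  exact ⟨a - c, Submodule.sub_mem _ ha (Bd_succ_le_Zc K r p n hc),
    by rw [map_sub, hcb, sub_sub_cancel]⟩
end

section
/- For every r ≥ 0, morphisms Z_r(f) and Z_{r+1}(f) of a morphism f of filtered complexes are both bidegree-wise surjective if and only if Z_r(f) and E_{r+1}(f) are both bidegree-wise surjective. -/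
open scoped Classical

variable {R : Type} [CommRing R]

theorem Zc_pred_le_Zc_succ {R : Type} [CommRing R] (A : FilteredComplex R) (r : ℕ) (p n : ℤ) :
    Zc A r (p - 1) n ≤ Zc A (r + 1) p n := by
  rintro x ⟨hx, hdx⟩
  refine ⟨A.F_mono n (by omega) hx, A.F_mono (n + 1) ?_ hdx⟩
  push_cast
  omega

theorem d_mem_Zc {R : Type} [CommRing R] (A : FilteredComplex R) (r s : ℕ) (p m n : ℤ)
    (hmn : m + 1 = n) {x : A.X m} (hx : x ∈ Zc A r p m) :
    A.d m n x ∈ Zc A s (p - r) n := by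
  subst hmn
  refine Submodule.mem_inf.mpr ⟨hx.2, ?_⟩
  rw [Submodule.mem_comap, A.d_sq]
  exact Submodule.zero_mem _

theorem ZSurjF.eSurjF {R : Type} [CommRing R] {K L : FilteredComplex R} {φ : FCHom K L} {r : ℕ}
    (h : ZSurjF φ r) : ESurjF φ r := by
  intro p n b hb
  obtain ⟨a, ha, rfl⟩ := h p n b hb
  exact ⟨a, ha, by simp⟩

theorem ZSurjF.succ_of_eSurjF {R : Type} [CommRing R] {K L : FilteredComplex R} {φ : FCHom K L}
    {r : ℕ} (hZ : ZSurjF φ r) (hE : ESurjF φ (r + 1)) : ZSurjF φ (r + 1) := by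
  intro p n b hb
  obtain ⟨a, ha, hab⟩ := hE p n b hb
  obtain ⟨z, hz, y, ⟨w, hw, rfl⟩, hsum⟩ := Submodule.mem_sup.mp hab
  obtain ⟨z', hz', rfl⟩ := hZ _ _ z hz
  obtain ⟨w', hw', rfl⟩ := hZ _ _ w hw
  have hdw : K.d (n - 1) n w' ∈ Zc K (r + 1) p n := by
    have := d_mem_Zc K r (r + 1) _ (n - 1) n (by omega) hw'
    rwa [show p + ((r + 1 : ℕ) : ℤ) - 1 - r = p by push_cast; ring] at this
  refine ⟨a - (z' + K.d (n - 1) n w'),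
    sub_mem ha (add_mem (Zc_pred_le_Zc_succ K r p n hz') hdw), ?_⟩
  rw [map_sub, map_add, φ.comm, hsum, sub_sub_cancel]

/-- `Z_r(f)` and `Z_{r+1}(f)` are both bidegree-wise surjective iff `Z_r(f)` and
`E_{r+1}(f)` are both bidegree-wise surjective. -/
theorem stmt1 {R : Type} [CommRing R] {K L : FilteredComplex R} (φ : FCHom K L) (r : ℕ) :
    (ZSurjF φ r ∧ ZSurjF φ (r+1)) ↔ (ZSurjF φ r ∧ ESurjF φ (r+1)) := by
  exact ⟨fun h => ⟨h.1, h.2.eSurjF⟩, fun h => ⟨h.1, h.1.succ_of_eSurjF h.2⟩⟩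
end

section
/- Let A be a filtered complex and let 𝒵_r(p,n) be the filtered complex with R in degree n of pure weight p and R in degree n+1 of pure weight p−r, with identity differential. Then morphisms of filtered complexes 𝒵_r(p,n) → A are in natural bijection with elements of Z_r^{p,n+p}(A). -/
open scoped Classical

variable {R : Type} [CommRing R]

section Zobj
variable (R : Type) [CommRing R]

/-- Degree-`m` piece of the filtered complex `𝒵_r(p,n)`: a submodule of `R × R`,
where the first coordinate is the degree-`n` copy of `R` (pure weight `p`)
and the second is the degree-`n+1` copy (pure weight `p - r`). -/
noncomputable def ZobjS (p n : ℤ) (m : ℤ) : Submodule R (R × R) :=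
  (if m = n then (⊤ : Submodule R R) else ⊥).prod (if m = n + 1 then ⊤ else ⊥)

/-- The map `(x, y) ↦ (0, x)`, inducing the differential of `𝒵_r(p,n)`. -/
noncomputable def Zobjσ : (R × R) →ₗ[R] (R × R) :=
  LinearMap.prod 0 (LinearMap.fst R R R)

/-- The filtered complex `𝒵_r(p,n) = (R_(p)^n → R_(p-r)^{n+1})` with identity differential. -/
noncomputable def Zobj (r : ℕ) (p n : ℤ) : FilteredComplex R where
  X m := ↥(ZobjS R p n m)
  d i j :=
    if h : j = i + 1 ∧ i = n then
      (Zobjσ R).restrict (p := ZobjS R p n i) (q := ZobjS R p n j)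
        (by
          rintro ⟨x, y⟩ hx
          obtain ⟨h1, h2⟩ := h
          subst h1; subst h2
          constructor
          · exact Submodule.zero_mem _
          · simp [Zobjσ, ZobjS] at hx ⊢)
    else 0
  d_ne := by
    intro i j h
    beta_reduce
    rw [dif_neg]
    rintro ⟨h1, _⟩; exact h h1
  d_sq := by
    intro i j k x
    beta_reduce
    by_cases h2 : k = j + 1 ∧ j = n
    · rw [dif_pos h2]
      by_cases h1 : j = i + 1 ∧ i = n
      · exfalso
        obtain ⟨h1a, h1b⟩ := h1
        obtain ⟨h2a, h2b⟩ := h2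
        omega
      · rw [dif_neg h1]
        simp
    · rw [dif_neg h2]
      simp
  F m w := (((if p ≤ w then (⊤ : Submodule R R) else ⊥).prod
      (if p - (r:ℤ) ≤ w then ⊤ else ⊥))).comap (ZobjS R p n m).subtype
  F_mono := by
    intro m a b hab
    apply Submodule.comap_mono
    apply Submodule.prod_mono <;> split_ifs with h1 h2 <;>
      first
        | exact le_rfl
        | exact le_top
        | exact bot_le
        | exact absurd (le_trans h1 hab) h2
  d_filt := by
    intro i j w x hx
    beta_reduce
    by_cases h : j = i + 1 ∧ i = n
    · rw [dif_pos h]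
      obtain ⟨h1, h2⟩ := h
      subst h1; subst h2
      obtain ⟨hxa, hxb⟩ := hx
      refine ⟨Submodule.zero_mem _, ?_⟩
      have hx1 : (x : R × R).1 ∈ (if p ≤ w then (⊤ : Submodule R R) else ⊥) := hxa
      show ((Zobjσ R) (x : R × R)).2 ∈ _
      by_cases hle : p - (r:ℤ) ≤ w
      · rw [if_pos hle]; trivial
      · rw [if_neg hle]
        have hnw : ¬ p ≤ w := by omega
        rw [if_neg hnw] at hx1
        simpa [Zobjσ] using hx1
    · rw [dif_neg h]
      simp only [LinearMap.zero_apply]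
      exact Submodule.zero_mem _

/-- The canonical generator of `𝒵_r(p,n)` in degree `n`. -/
noncomputable def ZobjGen (r : ℕ) (p n : ℤ) : (Zobj R r p n).X n :=
  ⟨(1, 0), by
    constructor
    · simp [ZobjS]
    · exact Submodule.zero_mem _⟩

end Zobj

section Representability

variable {R : Type} [CommRing R] {r : ℕ} {p n : ℤ} {A : FilteredComplex R}

theorem Zobj_fst_eq_zero {m : ℤ} (hm : m ≠ n) (x : (Zobj R r p n).X m) : x.1.1 = 0 := by
  have h := x.2.1
  rw [if_neg hm] at h
  exact h

theorem Zobj_snd_eq_zero {m : ℤ} (hm : m ≠ n + 1) (x : (Zobj R r p n).X m) : x.1.2 = 0 := by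
  have h := x.2.2
  rw [if_neg hm] at h
  exact h

theorem Zobj_d_val (x : (Zobj R r p n).X n) :
    ((Zobj R r p n).d n (n + 1) x).1 = (0, x.1.1) := by
  simp only [Zobj]
  rw [dif_pos ⟨trivial, trivial⟩]
  rfl

theorem Zobj_d_eq_zero {i j : ℤ} (h : ¬(j = i + 1 ∧ i = n)) : (Zobj R r p n).d i j = 0 :=
  dif_neg h

theorem Zobj_eq_smul_gen (x : (Zobj R r p n).X n) : x = x.1.1 • ZobjGen R r p n := by
  refine Subtype.ext (Prod.ext ?_ ?_)
  · exact (mul_one x.1.1).symm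
  · exact (Zobj_snd_eq_zero (by omega) x).trans (mul_zero x.1.1).symm

theorem Zobj_eq_smul_d_gen (x : (Zobj R r p n).X (n + 1)) :
    x = x.1.2 • (Zobj R r p n).d n (n + 1) (ZobjGen R r p n) := by
  have hd := Zobj_d_val (ZobjGen R r p n)
  refine Subtype.ext ?_
  change x.1 = x.1.2 • ((Zobj R r p n).d n (n + 1) (ZobjGen R r p n)).1
  rw [hd]
  refine Prod.ext ?_ ?_
  · exact (Zobj_fst_eq_zero (by omega) x).trans (mul_zero x.1.2).symm
  · exact (mul_one x.1.2).symm

theorem ZobjGen_mem_Zc : ZobjGen R r p n ∈ Zc (Zobj R r p n) r p n := by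
  refine ⟨⟨?_, Submodule.zero_mem _⟩, ?_⟩
  · rw [if_pos le_rfl]
    trivial
  · change ((Zobj R r p n).d n (n + 1) (ZobjGen R r p n)).1 ∈ Submodule.prod _ _
    rw [Zobj_d_val]
    refine ⟨Submodule.zero_mem _, ?_⟩
    rw [if_pos le_rfl]
    trivial

theorem FCHom.map_mem_Zc {B : FilteredComplex R} (g : FCHom A B) {x : A.X n}
    (hx : x ∈ Zc A r p n) : g.f n x ∈ Zc B r p n := by
  refine ⟨g.filt n p x hx.1, ?_⟩
  change B.d n (n + 1) (g.f n x) ∈ B.F (n + 1) (p - (r : ℤ))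
  rw [← g.comm]
  exact g.filt _ _ _ hx.2

/-- The morphism `𝒵_r(p,n) → A` sending the canonical generator to a given `r`-cycle. -/
noncomputable def FCHom.ofCycle (a : Zc A r p n) : FCHom (Zobj R r p n) A where
  f m := ((LinearMap.fst R R R).smulRight (Pi.single n a.1 m : A.X m) +
    (LinearMap.snd R R R).smulRight (A.d n m a.1)).comp (ZobjS R p n m).subtype
  comm := by
    intro i j x
    change ((Zobj R r p n).d i j x).1.1 • (Pi.single n a.1 j : A.X j) +
        ((Zobj R r p n).d i j x).1.2 • A.d n j a.1 =
      A.d i j (x.1.1 • (Pi.single n a.1 i : A.X i) + x.1.2 • A.d n i a.1)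
    rw [map_add, map_smul, map_smul, A.d_sq, smul_zero, add_zero]
    by_cases h : j = i + 1 ∧ i = n
    · obtain ⟨rfl, rfl⟩ := h
      rw [Zobj_d_val, zero_smul, zero_add, Pi.single_eq_same]
    · rw [Zobj_d_eq_zero h]
      have hz : A.d i j (Pi.single n a.1 i) = 0 := by
        by_cases hi : i = n
        · rw [A.d_ne i j fun hj => h ⟨hj, hi⟩, LinearMap.zero_apply]
        · rw [Pi.single_eq_of_ne hi, map_zero]
      rw [hz, smul_zero]
      exact (congrArg₂ (· + ·) (zero_smul R _) (zero_smul R _)).trans (add_zero _)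
  filt := by
    intro m w x hx
    change x.1.1 • (Pi.single n a.1 m : A.X m) + x.1.2 • A.d n m a.1 ∈ A.F m w
    obtain ⟨h₁, h₂⟩ := hx
    refine add_mem ?_ ?_
    · by_cases hm : m = n
      · subst hm
        rw [Pi.single_eq_same]
        split_ifs at h₁ with hw
        · exact Submodule.smul_mem _ _ (A.F_mono m hw a.2.1)
        · have hx0 : x.1.1 = 0 := h₁
          rw [hx0, zero_smul]
          exact Submodule.zero_mem _
      · rw [Pi.single_eq_of_ne hm, smul_zero]
        exact Submodule.zero_mem _
    · by_cases hm : m = n + 1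
      · subst hm
        split_ifs at h₂ with hw
        · exact Submodule.smul_mem _ _ (A.F_mono (n + 1) hw a.2.2)
        · have hx0 : x.1.2 = 0 := h₂
          rw [hx0, zero_smul]
          exact Submodule.zero_mem _
      · rw [A.d_ne n m hm, LinearMap.zero_apply, smul_zero]
        exact Submodule.zero_mem _

theorem FCHom.ofCycle_gen (a : Zc A r p n) :
    (FCHom.ofCycle a).f n (ZobjGen R r p n) = a.1 := by
  change (1 : R) • (Pi.single n a.1 n : A.X n) + (0 : R) • A.d n n a.1 = a.1
  rw [Pi.single_eq_same, one_smul, zero_smul, add_zero]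

theorem FCHom.ext_f {B : FilteredComplex R} {g h : FCHom A B} (H : ∀ m x, g.f m x = h.f m x) :
    g = h := by
  obtain ⟨f, _, _⟩ := g
  obtain ⟨f', _, _⟩ := h
  obtain rfl : f = f' := funext fun m => LinearMap.ext (H m)
  rfl

theorem FCHom.ext_gen {g h : FCHom (Zobj R r p n) A}
    (H : g.f n (ZobjGen R r p n) = h.f n (ZobjGen R r p n)) : g = h := by
  refine FCHom.ext_f fun m x => ?_
  by_cases hm : m = n
  · subst hm
    rw [Zobj_eq_smul_gen x, map_smul, map_smul, H]
  by_cases hm' : m = n + 1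
  · subst hm'
    rw [Zobj_eq_smul_d_gen x, map_smul, map_smul, g.comm, h.comm, H]
  · obtain rfl : x = 0 :=
      Subtype.ext (Prod.ext (Zobj_fst_eq_zero hm x) (Zobj_snd_eq_zero hm' x))
    rw [map_zero, map_zero]

end Representability

/-- Representability of `Z_r`: morphisms of filtered complexes `𝒵_r(p,n) → A` are in
bijection with elements of `Z_r^{p,n+p}(A)`, via evaluation at the canonical generator. -/
theorem stmt2 {R : Type} [CommRing R] (r : ℕ) (p n : ℤ) (A : FilteredComplex R) :
    ∃ E : FCHom (Zobj R r p n) A ≃ (Zc A r p n),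
      ∀ g : FCHom (Zobj R r p n) A, ((E g : A.X n)) = g.f n (ZobjGen R r p n) := by
  exact ⟨{ toFun := fun g => ⟨g.f n (ZobjGen R r p n), g.map_mem_Zc ZobjGen_mem_Zc⟩
           invFun := FCHom.ofCycle
           left_inv := fun g => FCHom.ext_gen (FCHom.ofCycle_gen _)
           right_inv := fun a => Subtype.ext (FCHom.ofCycle_gen a) }, fun _ => rfl⟩
end

section
/- Let f, g : A → B be morphisms of filtered complexes and suppose there is an r-homotopy h from f to g, i.e. a degree −1 filtered map h : A → B with dh + hd = g − f and h(F_pA^n) ⊆ F_{p+r}B^{n-1}. Then the induced maps E_{r+1}(f) and E_{r+1}(g) on the (r+1)-stage of the spectral sequences are equal. -/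
open scoped Classical

variable {R : Type} [CommRing R]

/-- If `h` is an `r`-homotopy from `f` to `g` (a degree `-1` map, encoded in
"all indices" form with `h i j = 0` unless `j = i - 1`, with `dh + hd = g - f` and
`h(F_p A^n) ⊆ F_{p+r} B^{n-1}`), then `E_{r+1}(f) = E_{r+1}(g)`:
for every `(r+1)`-cycle `a` of `A`, `f(a) - g(a)` is an `(r+1)`-boundary of `B`. -/
theorem stmt4 {R : Type} [CommRing R] {A B : FilteredComplex R}
    (f g : FCHom A B) (r : ℕ)
    (h : ∀ i j : ℤ, A.X i →ₗ[R] B.X j)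
    (h_ne : ∀ i j, j ≠ i - 1 → h i j = 0)
    (hhom : ∀ (n : ℤ) (x : A.X n),
      B.d (n-1) n (h n (n-1) x) + h (n+1) n (A.d n (n+1) x) = g.f n x - f.f n x)
    (hfilt : ∀ (n p : ℤ) (x : A.X n), x ∈ A.F n p → h n (n-1) x ∈ B.F (n-1) (p + (r:ℤ))) :
    ∀ p n, ∀ a ∈ Zc A (r+1) p n, f.f n a - g.f n a ∈ Bd B (r+1) p n := by
  intro p n a ha
  have hhom' : ∀ (i j k : ℤ), j = i - 1 → k = i + 1 → ∀ x : A.X i,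
      B.d j i (h i j x) + h k i (A.d i k x) = g.f i x - f.f i x := by
    rintro i j k rfl rfl x
    exact hhom i x
  have hfilt' : ∀ (i j q s : ℤ), j = i - 1 → q + (r : ℤ) ≤ s →
      ∀ x ∈ A.F i q, h i j x ∈ B.F j s := by
    rintro i j q s rfl hs x hx
    exact B.F_mono _ hs (hfilt i q x hx)
  obtain ⟨ha₁, ha₂⟩ := Submodule.mem_inf.1 ha
  rw [Submodule.mem_comap] at ha₂
  push_cast at ha₂
  have h_hda : h (n + 1) n (A.d n (n + 1) a) ∈ Zc B r (p - 1) n := by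
    refine Submodule.mem_inf.2 ⟨hfilt' _ _ _ _ (by ring) (by linarith) _ ha₂, ?_⟩
    have key := hhom' (n + 1) n (n + 1 + 1) (by ring) rfl (A.d n (n + 1) a)
    rw [A.d_sq, map_zero, add_zero] at key
    rw [Submodule.mem_comap, key]
    exact B.F_mono _ (by linarith) (sub_mem (g.filt _ _ _ ha₂) (f.filt _ _ _ ha₂))
  have h_ha : h n (n - 1) a ∈ Zc B r (p + (r : ℤ)) (n - 1) := by
    refine Submodule.mem_inf.2 ⟨hfilt n p a ha₁, ?_⟩
    have h_dha : B.d (n - 1) n (h n (n - 1) a) ∈ B.F n p := by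
      rw [eq_sub_of_add_eq (hhom n a)]
      exact sub_mem (sub_mem (g.filt _ _ _ ha₁) (f.filt _ _ _ ha₁))
        (B.F_mono _ (by linarith) (Submodule.mem_inf.1 h_hda).1)
    rw [Submodule.mem_comap, add_sub_cancel_right, sub_add_cancel]
    exact h_dha
  have h_eq : f.f n a - g.f n a =
      -h (n + 1) n (A.d n (n + 1) a) + -B.d (n - 1) n (h n (n - 1) a) := by
    rw [← neg_sub, ← hhom n a]
    abel
  have h_idx : p + ((r + 1 : ℕ) : ℤ) - 1 = p + (r : ℤ) := by push_cast; ring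
  rw [h_eq, Bd, h_idx, Nat.add_sub_cancel]
  exact Submodule.add_mem_sup (neg_mem h_hda) (neg_mem (Submodule.mem_map_of_mem h_ha))
end

section
/- The r-shift functor S^r on filtered complexes is left adjoint to the r-décalage functor Dec^r: there is a natural bijection Hom(S^r A, B) ≅ Hom(A, Dec^r B). -/
open scoped Classical

variable {R : Type} [CommRing R]

/-- The adjunct `A → Dec^r B` of a morphism `S^r A → B`. -/
def FCHom.toDec {A B : FilteredComplex R} {r : ℕ} (g : FCHom (Shift r A) B) :
    FCHom A (Dec r B) where
  f := g.f
  comm := g.comm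
  filt := by
    have key : ∀ n p (x : A.X n), x ∈ A.F n p → g.f n x ∈ B.F n (p - (r:ℤ) * n) := by
      intro n p x hx
      refine g.filt n _ x ?_
      change x ∈ A.F n (p - (r:ℤ) * n + (r:ℤ) * n)
      rwa [sub_add_cancel]
    intro n p x hx
    refine ⟨key n p x hx, ?_⟩
    have h := key (n+1) p _ (A.d_filt n (n+1) p x hx)
    have e : g.f (n+1) (A.d n (n+1) x) = B.d n (n+1) (g.f n x) := g.comm n (n+1) x
    exact Eq.subst (motive := (· ∈ B.F (n+1) (p - (r:ℤ) * (n+1)))) e h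

/-- The adjunct `S^r A → B` of a morphism `A → Dec^r B`. -/
def FCHom.ofDec {A B : FilteredComplex R} {r : ℕ} (g : FCHom A (Dec r B)) :
    FCHom (Shift r A) B where
  f := g.f
  comm := g.comm
  filt := by
    intro n p x hx
    have h : g.f n x ∈ B.F n (p + (r:ℤ) * n - (r:ℤ) * n) := (g.filt n _ x hx).1
    rwa [add_sub_cancel_right] at h

/-- The shift `S^r` is left adjoint to the décalage `Dec^r`: there is a bijection
`Hom(S^r A, B) ≃ Hom(A, Dec^r B)` which is the identity on underlying maps. -/
theorem stmt6 {R : Type} [CommRing R] (A B : FilteredComplex R) (r : ℕ) :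
    ∃ E : FCHom (Shift r A) B ≃ FCHom A (Dec r B),
      ∀ g : FCHom (Shift r A) B, ∀ n, (E g).f n = g.f n := by
  exact ⟨⟨FCHom.toDec, FCHom.ofDec, fun _ => rfl, fun _ => rfl⟩, fun _ _ => rfl⟩
end

section
/- For every filtered complex A and every k ≥ 0, there is a natural isomorphism of bigraded modules E_{k+1}^{p,p+n}(S^1 A) ≅ E_k^{p+n, p+2n}(A), where S^1 is the shift functor. Consequently, a morphism f of filtered complexes is an E_k-quasi-isomorphism if and only if S^1(f) is an E_{k+1}-quasi-isomorphism. -/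
open scoped Classical

variable {R : Type} [CommRing R]

theorem Zc_shift_one_succ (A : FilteredComplex R) (k : ℕ) (p n : ℤ) :
    Zc (Shift 1 A) (k + 1) p n = Zc A k (p + n) n := by
  have source : p + ((1 : ℕ) : ℤ) * n = p + n := by simp
  have target : p - ((k + 1 : ℕ) : ℤ) + ((1 : ℕ) : ℤ) * (n + 1) = p + n - k := by
    push_cast
    ring
  change A.F n (p + ((1 : ℕ) : ℤ) * n) ⊓
    (A.F (n + 1) (p - ((k + 1 : ℕ) : ℤ) + ((1 : ℕ) : ℤ) * (n + 1))).comap (A.d n (n + 1)) =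
      A.F n (p + n) ⊓ (A.F (n + 1) (p + n - k)).comap (A.d n (n + 1))
  rw [source, target]

theorem Zc_zero (A : FilteredComplex R) (p n : ℤ) : Zc A 0 p n = A.F n p :=
  inf_eq_left.2 fun x hx => by simpa using A.d_filt n (n + 1) p x hx

/-- The case `k = 0` is special: there `k - 1` truncates to `0`. -/
theorem Zc_shift_one (A : FilteredComplex R) (k : ℕ) (p n : ℤ) :
    Zc (Shift 1 A) k p n = Zc A (k - 1) (p + n) n := by
  cases k with
  | zero =>
    rw [Zc_zero, Zc_zero]
    change A.F n (p + ((1 : ℕ) : ℤ) * n) = _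
    simp
  | succ k => exact Zc_shift_one_succ A k p n

theorem Bd_shift_one_succ (A : FilteredComplex R) (k : ℕ) (p n : ℤ) :
    Bd (Shift 1 A) (k + 1) p n = Bd A k (p + n) n := by
  have source : p - 1 + n = p + n - 1 := by ring
  have target : p + ((k + 1 : ℕ) : ℤ) - 1 + (n - 1) = p + n + k - 1 := by
    push_cast
    ring
  unfold Bd
  rw [Nat.add_sub_cancel, Zc_shift_one, Zc_shift_one, source, target]
  rfl

/-- `E_{k+1}^{p,p+n}(S^1 A) ≅ E_k^{p+n,p+2n}(A)`: the `(k+1)`-cycles and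
`(k+1)`-boundaries of the shift coincide with the `k`-cycles and `k`-boundaries of `A`
(after reindexing), so the identity induces a natural isomorphism of the corresponding
spectral sequence terms.  Consequently a morphism `φ` of filtered complexes is an
`E_k`-quasi-isomorphism iff `S^1 φ` is an `E_{k+1}`-quasi-isomorphism. -/
theorem stmt7 {R : Type} [CommRing R] (A B : FilteredComplex R) (φ : FCHom A B) (k : ℕ) :
    (∀ p n : ℤ, Zc (Shift 1 A) (k+1) p n = Zc A k (p+n) n ∧
      Bd (Shift 1 A) (k+1) p n = Bd A k (p+n) n) ∧
    (IsErQisF φ k ↔ IsErQisF (ShiftHom 1 φ) (k+1)) := by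
  refine ⟨fun p n => ⟨Zc_shift_one_succ A k p n, Bd_shift_one_succ A k p n⟩, ?_⟩
  have reindex (P : ℤ → ℤ → Prop) : (∀ p n, P p n) ↔ ∀ p n, P (p + n) n :=
    ⟨fun h p n => h (p + n) n, fun h p n => by simpa using h (p - n) n⟩
  refine and_congr ?_ ?_
  · refine (reindex _).trans (forall₂_congr fun p n => ?_)
    rw [Zc_shift_one_succ, Zc_shift_one_succ, Bd_shift_one_succ]
    rfl
  · refine (reindex _).trans (forall₂_congr fun p n => ?_)
    rw [Zc_shift_one_succ, Bd_shift_one_succ, Bd_shift_one_succ]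
    rfl
end

section
/- Let A be a bicomplex and r ≥ 1. Define ZW_r^{p,q}(A) as the set of tuples (a_0,…,a_{r−1}) with a_i ∈ A^{p−i,q−i}, d_0a_0 = 0 and d_1a_{i−1} = d_0a_i for 1 ≤ i ≤ r−1; define BW_r^{p,q−1}(A) (for r ≥ 2) as ZW_{r−1}^{p+r−1,q+r−2}(A) ⊕ A^{p,q−1} ⊕ ZW_{r−1}^{p−1,q−1}(A), and the map w_r : BW_r^{p,q−1}(A) → ZW_r^{p,q}(A) by (b_0,…,b_{r−2}; a; c_0,…,c_{r−2}) ↦ (d_0a + d_1b_{r−2}, d_1a + c_0, c_1,…,c_{r−2}). Then the kernel of the natural projection π_r : ZW_r^{p,q}(A) → E_r^{p,q}(A), (a_0,…,a_{r−1}) ↦ [a_0], equals the image of w_r; hence E_r^{p,q}(A) ≅ ZW_r^{p,q}(A)/w_r(BW_r^{p,q−1}(A)). -/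
open scoped Classical

/-- A bicomplex of `R`-modules, with commuting differentials `d0` of bidegree `(0,1)`
and `d1` of bidegree `(-1,0)`, encoded in "all indices" form: `d0 i j i' j'` is the
component `X i j → X i' j'`, which vanishes unless `(i',j') = (i, j+1)`, and similarly
`d1` vanishes unless `(i',j') = (i-1, j)`. -/
structure Bicomplex (R : Type) [CommRing R] where
  X : ℤ → ℤ → Type
  [addgrp : ∀ i j, AddCommGroup (X i j)]
  [mod : ∀ i j, Module R (X i j)]
  d0 : ∀ i j i' j', X i j →ₗ[R] X i' j'
  d1 : ∀ i j i' j', X i j →ₗ[R] X i' j'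
  d0_ne : ∀ i j i' j', ¬(i' = i ∧ j' = j + 1) → d0 i j i' j' = 0
  d1_ne : ∀ i j i' j', ¬(i' = i - 1 ∧ j' = j) → d1 i j i' j' = 0
  d0_sq : ∀ i j i'' j'' x, d0 i (j+1) i'' j'' (d0 i j i (j+1) x) = 0
  d1_sq : ∀ i j i'' j'' x, d1 (i-1) j i'' j'' (d1 i j (i-1) j x) = 0
  comm : ∀ i j i'' j'' x,
    d0 (i-1) j i'' j'' (d1 i j (i-1) j x) = d1 i (j+1) i'' j'' (d0 i j i (j+1) x)

attribute [instance] Bicomplex.addgrp Bicomplex.mod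

variable {R : Type} [CommRing R]

/-- Transport an element of `A.X i j` along equalities of the indices. -/
def Bicomplex.cst (A : Bicomplex R) {i j i' j' : ℤ} (h1 : i = i') (h2 : j = j')
    (x : A.X i j) : A.X i' j' := cast (by rw [h1, h2]) x

/-- Morphisms of bicomplexes. -/
structure BicomplexHom (K L : Bicomplex R) where
  f : ∀ i j, K.X i j →ₗ[R] L.X i j
  comm0 : ∀ i j i' j' x, f i' j' (K.d0 i j i' j' x) = L.d0 i j i' j' (f i j x)
  comm1 : ∀ i j i' j' x, f i' j' (K.d1 i j i' j' x) = L.d1 i j i' j' (f i j x)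

def BicomplexHom.comp {K L M : Bicomplex R} (g : BicomplexHom L M) (φ : BicomplexHom K L) :
    BicomplexHom K M where
  f := fun i j => (g.f i j).comp (φ.f i j)
  comm0 := by intro i j i' j' x; simp [LinearMap.comp_apply, φ.comm0, g.comm0]
  comm1 := by intro i j i' j' x; simp [LinearMap.comp_apply, φ.comm1, g.comm1]

def BicomplexHom.id' (K : Bicomplex R) : BicomplexHom K K :=
  ⟨fun _ _ => LinearMap.id, fun _ _ _ _ _ => rfl, fun _ _ _ _ _ => rfl⟩

def BicomplexHom.zero (K L : Bicomplex R) : BicomplexHom K L :=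
  ⟨fun _ _ => 0, by intro i j i' j' x; simp, by intro i j i' j' x; simp⟩

/-- Tuples `(a_0, …, a_{m-1})` with `a_k ∈ A^{P-k, Q-k}` (a staircase of entries). -/
def ZWTuple (A : Bicomplex R) (m : ℕ) (P Q : ℤ) :=
  ∀ k : Fin m, A.X (P - (k.1:ℤ)) (Q - (k.1:ℤ))

/-- The witness chain conditions `d_1 a_k = d_0 a_{k+1}`. -/
def WChain (A : Bicomplex R) (m : ℕ) (P Q : ℤ) (b : ZWTuple A m P Q) : Prop :=
  ∀ (k : ℕ) (h : k + 1 < m),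
    A.d1 (P - ((k:ℕ):ℤ)) (Q - ((k:ℕ):ℤ)) (P - ((k+1:ℕ):ℤ)) (Q - ((k:ℕ):ℤ))
        (b ⟨k, Nat.lt_of_succ_lt h⟩) =
      A.d0 (P - ((k+1:ℕ):ℤ)) (Q - ((k+1:ℕ):ℤ)) (P - ((k+1:ℕ):ℤ)) (Q - ((k:ℕ):ℤ))
        (b ⟨k+1, h⟩)

/-- `b` is a witness `m`-cycle: `d_0 b_0 = 0` and `d_1 b_k = d_0 b_{k+1}`.
This is the set `ZW_m^{P,Q}(A)` (for `m ≥ 1`). -/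
def IsZWT (A : Bicomplex R) (m : ℕ) (P Q : ℤ) (b : ZWTuple A m P Q) : Prop :=
  (∀ h : 0 < m,
    A.d0 (P - ((0:ℕ):ℤ)) (Q - ((0:ℕ):ℤ)) (P - ((0:ℕ):ℤ)) (Q - ((0:ℕ):ℤ) + 1) (b ⟨0, h⟩) = 0)
  ∧ WChain A m P Q b

/-- `(x, t)` is a witness `(m+1)`-cycle in head/tail form: `x ∈ A^{p,q}` with
`d_0 x = 0`, and `t = (a_1, …, a_m)` a chain of witnesses with `d_1 x = d_0 a_1`. -/
def IsWit (A : Bicomplex R) (m : ℕ) (p q : ℤ) (x : A.X p q)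
    (t : ZWTuple A m (p-1) (q-1)) : Prop :=
  A.d0 p q p (q+1) x = 0 ∧ WChain A m (p-1) (q-1) t ∧
  ∀ h : 0 < m,
    A.d1 p q (p - 1 - ((0:ℕ):ℤ)) (q - 1 - ((0:ℕ):ℤ) + 1) x =
      A.d0 (p - 1 - ((0:ℕ):ℤ)) (q - 1 - ((0:ℕ):ℤ)) (p - 1 - ((0:ℕ):ℤ))
        (q - 1 - ((0:ℕ):ℤ) + 1) (t ⟨0, h⟩)

/-- `x ∈ Z_r^{p,q}(A)`: the `r`-cycles of the (column-filtration) spectral sequence of a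
bicomplex, in the explicit form of Lemma `classical_ss`. -/
def IsZ (A : Bicomplex R) (r : ℕ) (p q : ℤ) (x : A.X p q) : Prop :=
  match r with
  | 0 => True
  | m+1 => ∃ t : ZWTuple A m (p-1) (q-1), IsWit A m p q x t

/-- `x ∈ B_r^{p,q}(A)`: the `r`-boundaries of the (column-filtration) spectral sequence
of a bicomplex, in the explicit form of Lemma `classical_ss`. -/
def IsB (A : Bicomplex R) (r : ℕ) (p q : ℤ) (x : A.X p q) : Prop :=
  match r with
  | 0 => x = 0
  | 1 => ∃ y : A.X p (q-1), A.d0 p (q-1) p q y = x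
  | m+2 => ∃ b : ZWTuple A (m+2) (p+(m:ℤ)+1) (q+(m:ℤ)),
      (A.d0 (p+(m:ℤ)+1 - ((0:ℕ):ℤ)) (q+(m:ℤ) - ((0:ℕ):ℤ)) (p+(m:ℤ)+1 - ((0:ℕ):ℤ))
          (q+(m:ℤ) - ((0:ℕ):ℤ) + 1) (b ⟨0, by omega⟩) = 0)
      ∧ (∀ (k : ℕ) (h : k + 1 ≤ m),
          A.d1 (p+(m:ℤ)+1 - ((k:ℕ):ℤ)) (q+(m:ℤ) - ((k:ℕ):ℤ)) (p+(m:ℤ)+1 - ((k+1:ℕ):ℤ))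
              (q+(m:ℤ) - ((k:ℕ):ℤ)) (b ⟨k, by omega⟩) =
            A.d0 (p+(m:ℤ)+1 - ((k+1:ℕ):ℤ)) (q+(m:ℤ) - ((k+1:ℕ):ℤ))
              (p+(m:ℤ)+1 - ((k+1:ℕ):ℤ)) (q+(m:ℤ) - ((k:ℕ):ℤ)) (b ⟨k+1, by omega⟩))
      ∧ x = A.d0 (p+(m:ℤ)+1 - ((m+1:ℕ):ℤ)) (q+(m:ℤ) - ((m+1:ℕ):ℤ)) p q (b ⟨m+1, by omega⟩)
          + A.d1 (p+(m:ℤ)+1 - ((m:ℕ):ℤ)) (q+(m:ℤ) - ((m:ℕ):ℤ)) p q (b ⟨m, by omega⟩)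

/-- `ZW_r(φ)` is bidegree-wise surjective (`ZW_0 = A`). -/
def ZWSurj {K L : Bicomplex R} (φ : BicomplexHom K L) (r : ℕ) : Prop :=
  match r with
  | 0 => ∀ p q, Function.Surjective (φ.f p q)
  | m+1 => ∀ (P Q : ℤ) (b : ZWTuple L (m+1) P Q), IsZWT L (m+1) P Q b →
      ∃ a : ZWTuple K (m+1) P Q, IsZWT K (m+1) P Q a ∧
        ∀ k : Fin (m+1), φ.f (P - (k.1:ℤ)) (Q - (k.1:ℤ)) (a k) = b k

/-- `Z_r(φ)` is bidegree-wise surjective. -/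
def ZSurj {K L : Bicomplex R} (φ : BicomplexHom K L) (r : ℕ) : Prop :=
  ∀ p q y, IsZ L r p q y → ∃ x, IsZ K r p q x ∧ φ.f p q x = y

/-- `E_r(φ)` is bidegree-wise surjective (elementwise formulation). -/
def ESurj {K L : Bicomplex R} (φ : BicomplexHom K L) (r : ℕ) : Prop :=
  ∀ p q y, IsZ L r p q y → ∃ x, IsZ K r p q x ∧ IsB L r p q (φ.f p q x - y)

/-- `E_r(φ)` is bidegree-wise injective (elementwise formulation). -/
def EInj {K L : Bicomplex R} (φ : BicomplexHom K L) (r : ℕ) : Prop :=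
  ∀ p q x, IsZ K r p q x → IsB L r p q (φ.f p q x) → IsB K r p q x

/-- `φ` is an `E_r`-quasi-isomorphism: `E_{r+1}(φ)` is an isomorphism. -/
def IsErQis {K L : Bicomplex R} (φ : BicomplexHom K L) (r : ℕ) : Prop :=
  ESurj φ (r+1) ∧ EInj φ (r+1)

theorem Bicomplex.d1_d1 (A : Bicomplex R) {i j i' j' i'' j'' : ℤ} (x : A.X i j) :
    A.d1 i' j' i'' j'' (A.d1 i j i' j' x) = 0 := by
  by_cases h : i' = i - 1 ∧ j' = j
  · obtain ⟨rfl, rfl⟩ := h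
    exact A.d1_sq _ _ _ _ _
  · simp [A.d1_ne _ _ _ _ h]

theorem Bicomplex.d0_d1 (A : Bicomplex R) {i j i₁ j₁ i₂ j₂ k l : ℤ} (hi₁ : i₁ = i - 1)
    (hj₁ : j₁ = j) (hi₂ : i₂ = i) (hj₂ : j₂ = j + 1) (x : A.X i j) :
    A.d0 i₁ j₁ k l (A.d1 i j i₁ j₁ x) = A.d1 i₂ j₂ k l (A.d0 i j i₂ j₂ x) := by
  subst hi₁ hj₁ hi₂ hj₂
  exact A.comm _ _ _ _ _

theorem Bicomplex.d0_cst (A : Bicomplex R) {i j i' j' k l : ℤ} (hi : i = i') (hj : j = j')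
    (x : A.X i j) : A.d0 i' j' k l (A.cst hi hj x) = A.d0 i j k l x := by
  subst hi hj
  rfl

/-- If `(x, t)` is a witness cycle with `x = d_0 a + d_1 y`, then subtracting `d_1 a` from the
first entry of `t` gives a witness cycle. -/
theorem IsWit.exists_isZWT_tail {A : Bicomplex R} {m : ℕ} {p q i j : ℤ} {x : A.X p q}
    {t : ZWTuple A (m + 1) (p - 1) (q - 1)} (hw : IsWit A (m + 1) p q x t)
    (a : A.X p (q - 1)) (y : A.X i j) (hx : x = A.d0 p (q - 1) p q a + A.d1 i j p q y) :
    ∃ c : ZWTuple A (m + 1) (p - 1) (q - 1), IsZWT A (m + 1) (p - 1) (q - 1) c ∧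
      t ⟨0, m.succ_pos⟩ =
        A.d1 p (q - 1) (p - 1 - ((0 : ℕ) : ℤ)) (q - 1 - ((0 : ℕ) : ℤ)) a +
          c ⟨0, m.succ_pos⟩ ∧
      ∀ (k : ℕ) (_ : 1 ≤ k) (h : k < m + 1), t ⟨k, h⟩ = c ⟨k, h⟩ := by
  obtain ⟨-, ht, ht0⟩ := hw
  let c : ZWTuple A (m + 1) (p - 1) (q - 1) := fun k =>
    if k.1 = 0 then t k - A.d1 p (q - 1) (p - 1 - (k.1 : ℤ)) (q - 1 - (k.1 : ℤ)) a else t k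
  have hc0 : c ⟨0, m.succ_pos⟩ = t ⟨0, m.succ_pos⟩ -
      A.d1 p (q - 1) (p - 1 - ((0 : ℕ) : ℤ)) (q - 1 - ((0 : ℕ) : ℤ)) a := if_pos rfl
  have hc : ∀ (k : ℕ) (_ : 1 ≤ k) (h : k < m + 1), c ⟨k, h⟩ = t ⟨k, h⟩ :=
    fun k hk h => if_neg (Nat.one_le_iff_ne_zero.mp hk)
  refine ⟨c, ⟨fun _ => ?_, fun k hk => ?_⟩, ?_, fun k hk h => (hc k hk h).symm⟩
  · rw [hc0, map_sub, ← ht0 m.succ_pos,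
      A.d0_d1 (i₂ := p) (j₂ := q) (by simp) (by simp) rfl (by simp), hx, map_add, A.d1_d1,
      add_zero, sub_self]
  · rw [hc (k + 1) (Nat.le_add_left 1 k) hk, ← ht k hk]
    rcases Nat.eq_zero_or_pos k with rfl | hk0
    · rw [hc0, map_sub, A.d1_d1, sub_zero]
    · rw [hc k hk0]
  · rw [hc0, add_sub_cancel]

/-- The description of `B_{m+2}` in which the last entry of the tuple is split off. -/
theorem isB_add_two_iff {A : Bicomplex R} {m : ℕ} {p q : ℤ} {x : A.X p q} :
    IsB A (m + 2) p q x ↔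
      ∃ (b : ZWTuple A (m + 1) (p + (m : ℤ) + 1) (q + (m : ℤ))) (a : A.X p (q - 1)),
        IsZWT A (m + 1) (p + (m : ℤ) + 1) (q + (m : ℤ)) b ∧
        x = A.d0 p (q - 1) p q a +
          A.d1 (p + (m : ℤ) + 1 - (m : ℤ)) (q + (m : ℤ) - (m : ℤ)) p q
            (b ⟨m, m.lt_succ_self⟩) := by
  have hi : p + (m : ℤ) + 1 - ((m + 1 : ℕ) : ℤ) = p := by push_cast; ring
  have hj : q + (m : ℤ) - ((m + 1 : ℕ) : ℤ) = q - 1 := by push_cast; ring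
  constructor
  · rintro ⟨b, hb0, hb, hx⟩
    refine ⟨fun k => b ⟨k.1, by omega⟩, A.cst hi hj (b ⟨m + 1, by omega⟩),
      ⟨fun _ => hb0, fun k hk => hb k (by omega)⟩, ?_⟩
    rw [A.d0_cst]
    exact hx
  · rintro ⟨b, a, ⟨hb0, hb⟩, hx⟩
    let b' : ZWTuple A (m + 2) (p + (m : ℤ) + 1) (q + (m : ℤ)) := fun k =>
      if h : k.1 < m + 1 then b ⟨k.1, h⟩
      else A.cst (by omega) (by omega) a
    have hb' : ∀ (k : ℕ) (h : k < m + 1), b' ⟨k, by omega⟩ = b ⟨k, h⟩ := fun k h => dif_pos h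
    have hb'_last : b' ⟨m + 1, by omega⟩ = A.cst hi.symm hj.symm a := dif_neg (lt_irrefl _)
    refine ⟨b', ?_, fun k hk => ?_, ?_⟩
    · rw [hb' 0 m.succ_pos]
      exact hb0 m.succ_pos
    · rw [hb' k (by omega), hb' (k + 1) (by omega)]
      exact hb k (by omega)
    · rw [hb'_last, hb' m m.lt_succ_self, A.d0_cst]
      exact hx

/-- `Ker π_r = Im w_r` (r ≥ 2): a witness `r`-cycle `(x, t)` (head/tail form) maps to
zero in `E_r^{p,q}(A)` (i.e. `x ∈ B_r^{p,q}(A)`) if and only if it lies in the image of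
`w_r : BW_r^{p,q-1}(A) → ZW_r^{p,q}(A)`,
`(b_0,…,b_{r-2}; a; c_0,…,c_{r-2}) ↦ (d_0 a + d_1 b_{r-2}, d_1 a + c_0, c_1, …, c_{r-2})`.
Hence `E_r^{p,q}(A) ≅ ZW_r^{p,q}(A)/w_r(BW_r^{p,q-1}(A))`. -/
theorem stmt11 {R : Type} [CommRing R] (A : Bicomplex R) (r : ℕ) (hr : 2 ≤ r) (p q : ℤ)
    (x : A.X p q) (t : ZWTuple A (r-1) (p-1) (q-1)) (hw : IsWit A (r-1) p q x t) :
    IsB A r p q x ↔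
      ∃ (b : ZWTuple A (r-1) (p + (r:ℤ) - 1) (q + (r:ℤ) - 2)) (a : A.X p (q-1))
        (c : ZWTuple A (r-1) (p-1) (q-1)),
        IsZWT A (r-1) (p + (r:ℤ) - 1) (q + (r:ℤ) - 2) b ∧
        IsZWT A (r-1) (p-1) (q-1) c ∧
        -- head: x = d_0 a + d_1 b_{r-2}
        x = A.d0 p (q-1) p q a +
            A.d1 (p + (r:ℤ) - 1 - ((r-2:ℕ):ℤ)) (q + (r:ℤ) - 2 - ((r-2:ℕ):ℤ)) p q
              (b ⟨r-2, by omega⟩) ∧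
        -- first tail entry: t_0 = d_1 a + c_0
        t ⟨0, by omega⟩ =
          A.d1 p (q-1) (p - 1 - ((0:ℕ):ℤ)) (q - 1 - ((0:ℕ):ℤ)) a + c ⟨0, by omega⟩ ∧
        -- remaining tail entries: t_m = c_m for 1 ≤ m ≤ r-2
        ∀ (m : ℕ) (h1 : 1 ≤ m) (h2 : m < r - 1), t ⟨m, h2⟩ = c ⟨m, h2⟩ := by
  obtain ⟨m, rfl⟩ := Nat.exists_eq_add_of_le' hr
  have hP : p + ((m + 2 : ℕ) : ℤ) - 1 = p + (m : ℤ) + 1 := by push_cast; ring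
  have hQ : q + ((m + 2 : ℕ) : ℤ) - 2 = q + (m : ℤ) := by push_cast; ring
  rw [isB_add_two_iff, hP, hQ]
  constructor
  · rintro ⟨b, a, hb, hx⟩
    obtain ⟨c, hc, h0, h⟩ := hw.exists_isZWT_tail a _ hx
    exact ⟨b, a, c, hb, hc, hx, h0, h⟩
  · rintro ⟨b, a, -, hb, -, hx, -⟩
    exact ⟨b, a, hb, hx⟩
end

section
/- Let f : A → B be a morphism of bicomplexes and r ≥ 0. If f has the left lifting property with respect to all morphisms g of bicomplexes for which ZW_k(g) is bidegree-wise surjective for k = 0 and k = r, then f is an E_r-quasi-isomorphism, i.e. E_{r+1}(f) is an isomorphism. -/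
open scoped Classical

variable {R : Type} [CommRing R]

namespace Bicomplex

/-- Families of elements of `B`, one in each bidegree. -/
abbrev Family (B : Bicomplex R) : Type := ∀ p q, B.X p q

/-- The vertical differential on families. -/
def D0 (B : Bicomplex R) : B.Family →ₗ[R] B.Family where
  toFun a := fun i j => B.d0 i (j - 1) i j (a i (j - 1))
  map_add' := by intro a b; funext i j; simp
  map_smul' := by intro c a; funext i j; simp

/-- The horizontal differential on families. -/
def D1 (B : Bicomplex R) : B.Family →ₗ[R] B.Family where
  toFun a := fun i j => B.d1 (i + 1) j i j (a (i + 1) j)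
  map_add' := by intro a b; funext i j; simp
  map_smul' := by intro c a; funext i j; simp

lemma d0_family (B : Bicomplex R) (a : B.Family) {i j i' j' : ℤ} (hi : i' = i)
    (hj : j' = j + 1) : B.d0 i j i' j' (a i j) = B.D0 a i' j' := by
  obtain rfl : j = j' - 1 := by omega
  subst hi
  rfl

lemma d1_family (B : Bicomplex R) (a : B.Family) {i j i' j' : ℤ} (hi : i' = i - 1)
    (hj : j' = j) : B.d1 i j i' j' (a i j) = B.D1 a i' j' := by
  obtain rfl : i = i' + 1 := by omega
  subst hj
  rfl

lemma D0_D0 (B : Bicomplex R) (a : B.Family) : B.D0 (B.D0 a) = 0 := by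
  funext i j
  obtain ⟨j, rfl⟩ : ∃ k, j = k + 1 + 1 := ⟨j - 2, by ring⟩
  rw [← B.d0_family (B.D0 a) (i := i) (j := j + 1) rfl rfl,
    ← B.d0_family a (i := i) (j := j) rfl rfl, B.d0_sq]
  rfl

lemma D1_D1 (B : Bicomplex R) (a : B.Family) : B.D1 (B.D1 a) = 0 := by
  funext i j
  obtain ⟨i, rfl⟩ : ∃ k, i = k - 1 - 1 := ⟨i + 2, by ring⟩
  rw [← B.d1_family (B.D1 a) (i := i - 1) (j := j) rfl rfl,
    ← B.d1_family a (i := i) (j := j) rfl rfl, B.d1_sq]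
  rfl

lemma D0_D1 (B : Bicomplex R) (a : B.Family) : B.D0 (B.D1 a) = B.D1 (B.D0 a) := by
  funext i j
  obtain ⟨i, rfl⟩ : ∃ k, i = k - 1 := ⟨i + 1, by ring⟩
  obtain ⟨j, rfl⟩ : ∃ k, j = k + 1 := ⟨j - 1, by ring⟩
  rw [← B.d0_family (B.D1 a) (i := i - 1) (j := j) rfl rfl,
    ← B.d1_family a (i := i) (j := j) rfl rfl,
    ← B.d1_family (B.D0 a) (i := i) (j := j + 1) rfl rfl,
    ← B.d0_family a (i := i) (j := j) rfl rfl, B.comm]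

/-- The bicomplex with the same module `V` in every bidegree and constant differentials. -/
def const (V : Type) [AddCommGroup V] [Module R V] (δ₀ δ₁ : V →ₗ[R] V)
    (h₀ : ∀ v, δ₀ (δ₀ v) = 0) (h₁ : ∀ v, δ₁ (δ₁ v) = 0) (h : ∀ v, δ₀ (δ₁ v) = δ₁ (δ₀ v)) :
    Bicomplex R where
  X _ _ := V
  d0 i j i' j' := if i' = i ∧ j' = j + 1 then δ₀ else 0
  d1 i j i' j' := if i' = i - 1 ∧ j' = j then δ₁ else 0
  d0_ne i j i' j' hn := if_neg hn
  d1_ne i j i' j' hn := if_neg hn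
  d0_sq i j i' j' v := by split_ifs <;> simp_all
  d1_sq i j i' j' v := by split_ifs <;> simp_all
  comm i j i' j' v := by split_ifs <;> simp_all

/-- The direct sum of two bicomplexes. -/
def prod (K L : Bicomplex R) : Bicomplex R where
  X i j := K.X i j × L.X i j
  d0 i j i' j' := (K.d0 i j i' j').prodMap (L.d0 i j i' j')
  d1 i j i' j' := (K.d1 i j i' j').prodMap (L.d1 i j i' j')
  d0_ne i j i' j' h := by rw [K.d0_ne _ _ _ _ h, L.d0_ne _ _ _ _ h]; rfl
  d1_ne i j i' j' h := by rw [K.d1_ne _ _ _ _ h, L.d1_ne _ _ _ _ h]; rfl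
  d0_sq i j i' j' x := Prod.ext (K.d0_sq _ _ _ _ _) (L.d0_sq _ _ _ _ _)
  d1_sq i j i' j' x := Prod.ext (K.d1_sq _ _ _ _ _) (L.d1_sq _ _ _ _ _)
  comm i j i' j' x := Prod.ext (K.comm _ _ _ _ _) (L.comm _ _ _ _ _)

/-- Staircases of families: `D0 a₀ = 0` and `D1 aₖ = D0 aₖ₊₁` for `k + 1 < r`. -/
def stair (B : Bicomplex R) (r : ℕ) : Submodule R (ℕ → B.Family) where
  carrier := {a | B.D0 (a 0) = 0 ∧ ∀ k, k + 1 < r → B.D1 (a k) = B.D0 (a (k + 1))}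
  add_mem' := by
    rintro a b ⟨ha, ha'⟩ ⟨hb, hb'⟩
    refine ⟨by simp [ha, hb], fun k hk => ?_⟩
    simp [ha' k hk, hb' k hk]
  zero_mem' := by simp
  smul_mem' := by
    rintro c a ⟨ha, ha'⟩
    refine ⟨by simp [ha], fun k hk => ?_⟩
    simp [ha' k hk]

/-- Generators of the free bicomplex on the families of `B`, together with those of the
representing objects of witness `r`-cycles. -/
abbrev PathMod (B : Bicomplex R) (r : ℕ) : Type :=
  (B.Family × B.Family × B.Family × B.Family) × (ℕ → B.stair r) × (ℕ → B.stair r)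

/-- The vertical differential on `PathMod`. -/
def pathD0 (B : Bicomplex R) (r : ℕ) : B.PathMod r →ₗ[R] B.PathMod r where
  toFun x := ((0, x.1.1, 0, x.1.2.2.1), 0, fun k => if k + 1 < r then x.2.1 (k + 1) else 0)
  map_add' x y := by
    refine Prod.ext (by simp) (Prod.ext (by simp) (funext fun k => ?_))
    by_cases h : k + 1 < r <;> simp [h]
  map_smul' c x := by
    refine Prod.ext (by simp) (Prod.ext (by simp) (funext fun k => ?_))
    by_cases h : k + 1 < r <;> simp [h]

/-- The horizontal differential on `PathMod`. -/
def pathD1 (B : Bicomplex R) (r : ℕ) : B.PathMod r →ₗ[R] B.PathMod r where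
  toFun x := ((0, 0, x.1.1, x.1.2.1), 0, x.2.1)
  map_add' x y := by simp
  map_smul' c x := by simp

/-- An `E_{r+1}`-acyclic bicomplex covering `B`. -/
def path (B : Bicomplex R) (r : ℕ) : Bicomplex R :=
  const (B.PathMod r) (B.pathD0 r) (B.pathD1 r)
    (fun v => by simp [pathD0]; rfl) (fun v => by simp [pathD1])
    (fun v => by simp [pathD0, pathD1]; rfl)

/-- The evaluation of `PathMod` in families. -/
def pathEval (B : Bicomplex R) (r : ℕ) : B.PathMod r →ₗ[R] B.Family where
  toFun x := x.1.1 + B.D0 x.1.2.1 + B.D1 x.1.2.2.1 + B.D0 (B.D1 x.1.2.2.2)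
    + ∑ k ∈ Finset.range r, (x.2.1 k).1 k + ∑ k ∈ Finset.range r, B.D1 ((x.2.2 k).1 k)
  map_add' x y := by simp [Finset.sum_add_distrib]; abel
  map_smul' c x := by simp [Finset.smul_sum]

lemma D0_D1_stair (B : Bicomplex R) {r k : ℕ} (a : B.stair r) (hk : k < r) :
    B.D0 (B.D1 (a.1 k)) = 0 := by
  rw [D0_D1]
  cases k with
  | zero => rw [a.2.1, map_zero]
  | succ k => rw [← a.2.2 k hk, D1_D1]

lemma pathEval_pathD0 (B : Bicomplex R) (r : ℕ) (x : B.PathMod r) :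
    B.pathEval r (B.pathD0 r x) = B.D0 (B.pathEval r x) := by
  have h1 : ∑ k ∈ Finset.range r, B.D0 (B.D1 ((x.2.2 k).1 k)) = 0 :=
    Finset.sum_eq_zero fun k hk => B.D0_D1_stair _ (Finset.mem_range.1 hk)
  have h2 : ∑ k ∈ Finset.range r,
      B.D1 ((if k + 1 < r then x.2.1 (k + 1) else 0 : B.stair r).1 k) =
      ∑ k ∈ Finset.range r, B.D0 ((x.2.1 k).1 k) := by
    cases r with
    | zero => simp
    | succ m =>
      rw [Finset.sum_range_succ, Finset.sum_range_succ', (x.2.1 0).2.1]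
      congr 1
      · refine Finset.sum_congr rfl fun k hk => ?_
        have hk : k + 1 < m + 1 := by simpa using hk
        rw [if_pos hk, (x.2.1 (k + 1)).2.2 k hk]
      · simp
  simp only [pathEval, pathD0, LinearMap.coe_mk, AddHom.coe_mk, map_add, map_sum, h1, h2,
    D0_D0, map_zero]
  simp

lemma pathEval_pathD1 (B : Bicomplex R) (r : ℕ) (x : B.PathMod r) :
    B.pathEval r (B.pathD1 r x) = B.D1 (B.pathEval r x) := by
  simp [pathEval, pathD1, D1_D1, D0_D1]

end Bicomplex

open Bicomplex

/-- The covering of `B` by its acyclic bicomplex `path`. -/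
def BicomplexHom.ofPath (B : Bicomplex R) (r : ℕ) : BicomplexHom (B.path r) B where
  f i j := (LinearMap.proj j).comp ((LinearMap.proj i).comp (B.pathEval r))
  comm0 i j i' j' x := by
    by_cases h : i' = i ∧ j' = j + 1
    · change B.pathEval r ((if i' = i ∧ j' = j + 1 then B.pathD0 r else 0) x) i' j' =
        B.d0 i j i' j' (B.pathEval r x i j)
      rw [if_pos h, B.d0_family _ h.1 h.2]
      exact congrFun (congrFun (B.pathEval_pathD0 r x) i') j'
    · rw [B.d0_ne _ _ _ _ h, (B.path r).d0_ne _ _ _ _ h]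
      simp
  comm1 i j i' j' x := by
    by_cases h : i' = i - 1 ∧ j' = j
    · change B.pathEval r ((if i' = i - 1 ∧ j' = j then B.pathD1 r else 0) x) i' j' =
        B.d1 i j i' j' (B.pathEval r x i j)
      rw [if_pos h, B.d1_family _ h.1 h.2]
      exact congrFun (congrFun (B.pathEval_pathD1 r x) i') j'
    · rw [B.d1_ne _ _ _ _ h, (B.path r).d1_ne _ _ _ _ h]
      simp

/-- The morphism out of a direct sum with given components. -/
def BicomplexHom.coprod {K L M : Bicomplex R} (φ : BicomplexHom K M) (ψ : BicomplexHom L M) :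
    BicomplexHom (K.prod L) M where
  f i j := (φ.f i j).coprod (ψ.f i j)
  comm0 i j i' j' x := by
    change φ.f i' j' (K.d0 i j i' j' x.1) + ψ.f i' j' (L.d0 i j i' j' x.2) =
      M.d0 i j i' j' (φ.f i j x.1 + ψ.f i j x.2)
    rw [map_add, φ.comm0, ψ.comm0]
  comm1 i j i' j' x := by
    change φ.f i' j' (K.d1 i j i' j' x.1) + ψ.f i' j' (L.d1 i j i' j' x.2) =
      M.d1 i j i' j' (φ.f i j x.1 + ψ.f i j x.2)
    rw [map_add, φ.comm1, ψ.comm1]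

/-- The inclusion of the first summand. -/
def BicomplexHom.inl (K L : Bicomplex R) : BicomplexHom K (K.prod L) where
  f i j := LinearMap.inl R (K.X i j) (L.X i j)
  comm0 i j i' j' _ := Prod.ext rfl (map_zero (L.d0 i j i' j')).symm
  comm1 i j i' j' _ := Prod.ext rfl (map_zero (L.d1 i j i' j')).symm

/-- The inclusion of the second summand. -/
def BicomplexHom.inr (K L : Bicomplex R) : BicomplexHom L (K.prod L) where
  f i j := LinearMap.inr R (K.X i j) (L.X i j)
  comm0 i j i' j' _ := Prod.ext (map_zero (K.d0 i j i' j')).symm rfl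
  comm1 i j i' j' _ := Prod.ext (map_zero (K.d1 i j i' j')).symm rfl

lemma BicomplexHom.coprod_comp_inl {K L M : Bicomplex R} (φ : BicomplexHom K M)
    (ψ : BicomplexHom L M) : (φ.coprod ψ).comp (BicomplexHom.inl K L) = φ := by
  have h : ((φ.coprod ψ).comp (BicomplexHom.inl K L)).f = φ.f := by
    funext i j
    refine LinearMap.ext fun x => ?_
    change φ.f i j x + ψ.f i j 0 = φ.f i j x
    rw [map_zero, add_zero]
  cases φ
  exact (BicomplexHom.mk.injEq ..).mpr h

/-- The projection to the first summand. -/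
def BicomplexHom.fst (K L : Bicomplex R) : BicomplexHom (K.prod L) K where
  f i j := LinearMap.fst R (K.X i j) (L.X i j)
  comm0 _ _ _ _ _ := rfl
  comm1 _ _ _ _ _ := rfl

/-- The projection to the second summand. -/
def BicomplexHom.snd (K L : Bicomplex R) : BicomplexHom (K.prod L) L where
  f i j := LinearMap.snd R (K.X i j) (L.X i j)
  comm0 _ _ _ _ _ := rfl
  comm1 _ _ _ _ _ := rfl

lemma IsZ.map {K L : Bicomplex R} (φ : BicomplexHom K L) {r : ℕ} {p q : ℤ} {x : K.X p q}
    (h : IsZ K r p q x) : IsZ L r p q (φ.f p q x) := by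
  cases r with
  | zero => trivial
  | succ m =>
    obtain ⟨t, h0, h1, h2⟩ := h
    refine ⟨fun k => φ.f _ _ (t k), ?_, fun k hk => ?_, fun hm => ?_⟩
    · rw [← φ.comm0, h0, map_zero]
    · rw [← φ.comm0, ← φ.comm1, h1 k hk]
    · rw [← φ.comm0, ← φ.comm1, h2 hm]

lemma IsB.map {K L : Bicomplex R} (φ : BicomplexHom K L) {r : ℕ} {p q : ℤ} {x : K.X p q}
    (h : IsB K r p q x) : IsB L r p q (φ.f p q x) := by
  match r, h with
  | 0, h =>
    have h : x = 0 := h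
    show φ.f p q x = 0
    rw [h, map_zero]
  | 1, ⟨y, hy⟩ => exact ⟨φ.f _ _ y, by rw [← φ.comm0, hy]⟩
  | m + 2, ⟨b, h0, h1, h2⟩ =>
    refine ⟨fun k => φ.f _ _ (b k), ?_, fun k hk => ?_, ?_⟩
    · rw [← φ.comm0, h0, map_zero]
    · rw [← φ.comm0, ← φ.comm1, h1 k hk]
    · rw [h2, map_add, φ.comm0, φ.comm1]

lemma IsB.of_families (B : Bicomplex R) (m : ℕ) (p q : ℤ) (b : ℕ → B.Family)
    (h0 : B.D0 (b 0) = 0) (h1 : ∀ k, k + 1 ≤ m → B.D1 (b k) = B.D0 (b (k + 1))) :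
    IsB B (m + 2) p q ((B.D0 (b (m + 1)) + B.D1 (b m)) p q) := by
  refine ⟨fun k => b k.1 _ _, ?_, fun k hk => ?_, ?_⟩
  · rw [B.d0_family (b 0) rfl rfl, h0]
    rfl
  · rw [B.d0_family (b (k + 1)) rfl (by push_cast; ring),
      B.d1_family (b k) (by push_cast; ring) rfl, h1 k hk]
  · rw [B.d0_family (b (m + 1)) (by push_cast; ring) (by push_cast; ring),
      B.d1_family (b m) (by ring) (by ring)]
    rfl

lemma path_d0 (B : Bicomplex R) (r : ℕ) {i j i' j' : ℤ} (hi : i' = i) (hj : j' = j + 1)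
    (x : B.PathMod r) : (B.path r).d0 i j i' j' x = B.pathD0 r x := by
  show (if i' = i ∧ j' = j + 1 then B.pathD0 r else 0) x = _
  rw [if_pos ⟨hi, hj⟩]

lemma path_d1 (B : Bicomplex R) (r : ℕ) {i j i' j' : ℤ} (hi : i' = i - 1) (hj : j' = j)
    (x : B.PathMod r) : (B.path r).d1 i j i' j' x = B.pathD1 r x := by
  show (if i' = i - 1 ∧ j' = j then B.pathD1 r else 0) x = _
  rw [if_pos ⟨hi, hj⟩]

lemma path_cycle_zero (B : Bicomplex R) (r : ℕ) (hr : 0 < r) {p q : ℤ} {x : B.PathMod r}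
    (h : IsZ (B.path r) (r + 1) p q x) : x.2.1 0 = 0 := by
  obtain ⟨t, -, h1, h2⟩ := h
  have key : ∀ (i : ℕ) (hi : i < r), x.2.1 0 =
      if i + 1 < r then (show B.PathMod r from t ⟨i, hi⟩).2.1 (i + 1) else 0 := by
    intro i
    induction i with
    | zero =>
      intro hi
      have : B.pathD1 r x = B.pathD0 r (t ⟨0, hi⟩) :=
        (path_d1 B r (by simp) (by simp) x).symm.trans
          ((h2 hi).trans (path_d0 B r rfl rfl _))
      exact congrFun (congrArg (fun y : B.PathMod r => y.2.2) this) 0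
    | succ i ih =>
      intro hi
      rw [ih (by omega), if_pos hi]
      have : B.pathD1 r (t ⟨i, by omega⟩) = B.pathD0 r (t ⟨i + 1, hi⟩) :=
        (path_d1 B r (by push_cast; ring) rfl _).symm.trans
          ((h1 i hi).trans (path_d0 B r rfl (by push_cast; ring) _))
      exact congrFun (congrArg (fun y : B.PathMod r => y.2.2) this) (i + 1)
  rw [key (r - 1) (by omega), if_neg (by omega)]

lemma ofPath_isB (B : Bicomplex R) (r : ℕ) {p q : ℤ} {x : B.PathMod r}
    (h : IsZ (B.path r) (r + 1) p q x) :
    IsB B (r + 1) p q ((BicomplexHom.ofPath B r).f p q x) := by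
  have h0 : B.pathD0 r x = 0 := by
    obtain ⟨t, h0, -⟩ := h
    rwa [path_d0 B r rfl rfl] at h0
  have hx : x.1.1 = 0 := congrArg (fun y : B.PathMod r => y.1.2.1) h0
  have hz : x.1.2.2.1 = 0 := congrArg (fun y : B.PathMod r => y.1.2.2.2) h0
  have hu : ∀ k < r, x.2.1 k = 0 := by
    intro k hk
    cases k with
    | zero => exact path_cycle_zero B r hk h
    | succ k =>
      have := congrFun (congrArg (fun y : B.PathMod r => y.2.2) h0) k
      simpa [pathD0, hk] using this
  have hsum : ∑ k ∈ Finset.range r, (x.2.1 k).1 k = 0 :=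
    Finset.sum_eq_zero fun k hk => by rw [hu k (Finset.mem_range.1 hk)]; rfl
  show IsB B (r + 1) p q (B.pathEval r x p q)
  have hev : B.pathEval r x = B.D0 (x.1.2.1 + B.D1 x.1.2.2.2)
      + ∑ k ∈ Finset.range r, B.D1 ((x.2.2 k).1 k) := by
    simp [pathEval, hx, hz, hsum]
  rw [hev]
  cases r with
  | zero => exact ⟨(x.1.2.1 + B.D1 x.1.2.2.2) p (q - 1), by simp [D0]⟩
  | succ m =>
    let y : B.Family :=
      x.1.2.1 + B.D1 x.1.2.2.2 + ∑ k ∈ Finset.range m, (x.2.2 k).1 (k + 1)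
    let b : ℕ → B.Family := fun k => if k ≤ m then (x.2.2 m).1 k else y
    have hb : ∀ k ≤ m, b k = (x.2.2 m).1 k := fun k hk => if_pos hk
    have hy : B.D0 y = B.D0 (x.1.2.1 + B.D1 x.1.2.2.2)
        + ∑ k ∈ Finset.range m, B.D1 ((x.2.2 k).1 k) := by
      rw [map_add, map_sum]
      congr 1
      refine Finset.sum_congr rfl fun k hk => ((x.2.2 k).2.2 k ?_).symm
      have := Finset.mem_range.1 hk
      omega
    have := IsB.of_families B m p q b (by rw [hb 0 (by omega)]; exact (x.2.2 m).2.1)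
      (fun k hk => by
        rw [hb k (by omega), hb (k + 1) hk]
        exact (x.2.2 m).2.2 k (by omega))
    rw [hb m le_rfl, show b (m + 1) = y from if_neg (by omega), hy, add_assoc,
      ← Finset.sum_range_succ] at this
    exact this

/-- The family concentrated in one bidegree. -/
def Bicomplex.single (B : Bicomplex R) (p q : ℤ) (x : B.X p q) : B.Family :=
  Pi.single p (Pi.single q x)

lemma Bicomplex.single_self (B : Bicomplex R) (p q : ℤ) (x : B.X p q) :
    B.single p q x p q = x := by
  simp [Bicomplex.single]

lemma Bicomplex.single_ne (B : Bicomplex R) (p q : ℤ) (x : B.X p q) {i j : ℤ}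
    (h : ¬(i = p ∧ j = q)) : B.single p q x i j = 0 := by
  by_cases hi : i = p
  · subst hi
    simp [Bicomplex.single, Pi.single_eq_of_ne (show j ≠ q from fun hj => h ⟨rfl, hj⟩)]
  · simp [Bicomplex.single, Pi.single_eq_of_ne hi]

lemma Bicomplex.D0_single (B : Bicomplex R) (p q p' q' : ℤ) (hp : p' = p) (hq : q' = q + 1)
    (x : B.X p q) : B.D0 (B.single p q x) = B.single p' q' (B.d0 p q p' q' x) := by
  funext i j
  by_cases h : i = p' ∧ j = q'
  · obtain ⟨rfl, rfl⟩ := h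
    rw [single_self, ← B.d0_family _ hp hq, single_self]
  · rw [single_ne _ _ _ _ h, ← B.d0_family _ (i := i) (j := j - 1) rfl (by ring),
      single_ne _ _ _ _ (by omega), map_zero]

lemma Bicomplex.D1_single (B : Bicomplex R) (p q p' q' : ℤ) (hp : p' = p - 1) (hq : q' = q)
    (x : B.X p q) : B.D1 (B.single p q x) = B.single p' q' (B.d1 p q p' q' x) := by
  funext i j
  by_cases h : i = p' ∧ j = q'
  · obtain ⟨rfl, rfl⟩ := h
    rw [single_self, ← B.d1_family _ hp hq, single_self]
  · rw [single_ne _ _ _ _ h, ← B.d1_family _ (i := i + 1) (j := j) (by ring) rfl,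
      single_ne _ _ _ _ (by omega), map_zero]

lemma ofPath_surj_zero (B : Bicomplex R) (r : ℕ) : ZWSurj (BicomplexHom.ofPath B r) 0 := by
  intro p q y
  refine ⟨((B.single p q y, 0, 0, 0), 0, 0), ?_⟩
  show B.pathEval r ((B.single p q y, 0, 0, 0), 0, 0) p q = y
  simp [pathEval, B.single_self]

lemma ofPath_surj (B : Bicomplex R) (r : ℕ) : ZWSurj (BicomplexHom.ofPath B r) r := by
  cases r with
  | zero => exact ofPath_surj_zero B 0
  | succ m =>
    rintro P Q b ⟨hb0, hb⟩
    let a : ℕ → B.Family := fun k =>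
      if h : k < m + 1 then B.single (P - (k : ℤ)) (Q - (k : ℤ)) (b ⟨k, h⟩) else 0
    have ha : ∀ k (h : k < m + 1),
        a k = B.single (P - (k : ℤ)) (Q - (k : ℤ)) (b ⟨k, h⟩) := fun k h => dif_pos h
    have hmem : a ∈ B.stair (m + 1) := by
      refine ⟨?_, fun k hk => ?_⟩
      · rw [ha 0 (by omega), B.D0_single _ _ _ _ rfl rfl, hb0 (by omega)]
        simp [Bicomplex.single]
      · rw [ha k (by omega), ha (k + 1) hk,
          B.D1_single _ _ (P - ((k + 1 : ℕ) : ℤ)) (Q - (k : ℤ)) (by push_cast; ring) rfl,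
          B.D0_single _ _ (P - ((k + 1 : ℕ) : ℤ)) (Q - (k : ℤ)) rfl (by push_cast; ring),
          hb k hk]
    let u : ℕ → B.PathMod (m + 1) := fun k => (0, Pi.single k ⟨a, hmem⟩, 0)
    refine ⟨fun k => u k.1, ⟨fun _ => ?_, fun k hk => ?_⟩, fun k => ?_⟩
    · rw [path_d0 B _ rfl rfl]
      refine Prod.ext rfl (Prod.ext rfl (funext fun k => ?_))
      simp [pathD0, u]
      rfl
    · rw [path_d0 B _ rfl (by push_cast; ring), path_d1 B _ (by push_cast; ring) rfl]
      refine Prod.ext rfl (Prod.ext rfl (funext fun l => ?_))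
      by_cases hl : l = k
      · subst hl
        simp [pathD0, pathD1, u, show l < m by omega]
      · simp [pathD0, pathD1, u, hl]
    · show B.pathEval (m + 1) (u k.1) (P - (k.1 : ℤ)) (Q - (k.1 : ℤ)) = b k
      have : B.pathEval (m + 1) (u k.1) = a k.1 := by
        have hs : ∑ l ∈ Finset.range (m + 1),
            ((Pi.single k.1 ⟨a, hmem⟩ : ℕ → B.stair (m + 1)) l).1 l = a k.1 := by
          rw [Finset.sum_eq_single_of_mem k.1 (Finset.mem_range.2 k.2)]
          · simp
          · intro l _ hl
            rw [Pi.single_eq_of_ne hl]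
            rfl
        simp only [pathEval, u, LinearMap.coe_mk, AddHom.coe_mk, hs]
        simp
      rw [this, ha k.1 k.2, B.single_self]

lemma ZWSurj.coprod {K L M : Bicomplex R} (φ : BicomplexHom K M) (ψ : BicomplexHom L M)
    {r : ℕ} (h : ZWSurj ψ r) : ZWSurj (φ.coprod ψ) r := by
  have hinr : ∀ i j (x : L.X i j),
      (φ.coprod ψ).f i j ((BicomplexHom.inr K L).f i j x) = ψ.f i j x := by
    intro i j x
    change φ.f i j 0 + ψ.f i j x = ψ.f i j x
    rw [map_zero, zero_add]
  cases r with
  | zero =>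
    intro p q y
    obtain ⟨x, rfl⟩ := h p q y
    exact ⟨_, hinr p q x⟩
  | succ m =>
    intro P Q b hb
    obtain ⟨a, ⟨h0, h1⟩, h2⟩ := h P Q b hb
    let ι := BicomplexHom.inr K L
    refine ⟨fun k => ι.f _ _ (a k), ⟨fun hm => ?_, fun k hk => ?_⟩, fun k => ?_⟩
    · rw [← ι.comm0, h0 hm, map_zero]
    · rw [← ι.comm0, ← ι.comm1, h1 k hk]
    · rw [hinr, h2]

/-- If `f : A → B` has the left lifting property with respect to all morphisms `g` of
bicomplexes with `ZW_0(g)` and `ZW_r(g)` bidegree-wise surjective, then `f` is an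
`E_r`-quasi-isomorphism (`E_{r+1}(f)` is an isomorphism). -/
theorem stmt18 {R : Type} [CommRing R] {A B : Bicomplex R} (f : BicomplexHom A B) (r : ℕ)
    (hllp : ∀ (C D : Bicomplex R) (g : BicomplexHom C D), ZWSurj g 0 → ZWSurj g r →
      ∀ (α : BicomplexHom A C) (β : BicomplexHom B D),
        BicomplexHom.comp g α = BicomplexHom.comp β f →
          ∃ γ : BicomplexHom B C,
            BicomplexHom.comp γ f = α ∧ BicomplexHom.comp g γ = β) :
    IsErQis f r := by
  obtain ⟨γ, h1, h2⟩ := hllp (A.prod (B.path r)) B (f.coprod (BicomplexHom.ofPath B r))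
    (ZWSurj.coprod _ _ (ofPath_surj_zero B r)) (ZWSurj.coprod _ _ (ofPath_surj B r))
    (BicomplexHom.inl _ _) (BicomplexHom.id' B) (BicomplexHom.coprod_comp_inl _ _)
  have e1 : ∀ p q x, (γ.f p q (f.f p q x)).1 = x := fun p q x =>
    congrArg (fun φ : BicomplexHom A (A.prod (B.path r)) => (φ.f p q x).1) h1
  have e2 : ∀ p q y, f.f p q (γ.f p q y).1 + (BicomplexHom.ofPath B r).f p q (γ.f p q y).2 = y :=
    fun p q y => congrArg (fun φ : BicomplexHom B B => φ.f p q y) h2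
  refine ⟨fun p q y hy => ⟨(γ.f p q y).1, (hy.map γ).map (BicomplexHom.fst _ _), ?_⟩,
    fun p q x _ hx => ?_⟩
  · have := (ofPath_isB B r ((hy.map γ).map (BicomplexHom.snd _ _))).map
      (⟨fun _ _ => -LinearMap.id, by simp, by simp⟩ : BicomplexHom B B)
    convert this using 1
    exact sub_eq_iff_eq_add'.2 (eq_add_neg_of_add_eq (e2 p q y))
  · have := (hx.map γ).map (BicomplexHom.fst _ _)
    rw [← e1 p q x]
    exact this
end
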